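/- arXiv:1106.2703 — 5 statements merged into one kernel-verified Lean document; each statement's English description precedes it below -/
import Mathlib

section
/- For every real q with 0 < q < 1 and every real z, one has i·ϑ₁(i z ln q, q) = q^{-z²} · ((q;q)_∞² / (q²;q²)_∞) · sin_q(πz). Equivalently, as an identity of real numbers, ∑_{n∈ℤ} (−1)ⁿ q^{(n+1/2)²} q^{−(2n+1)z} = q^{−z²} · ((q;q)_∞² / (q²;q²)_∞) · sin_q(πz). -/
open Real

/-- The infinite q-Pochhammer symbol `(x; q)_∞ = ∏_{n=0}^∞ (1 - x qⁿ)`. -/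
noncomputable def qPoch (x q : ℝ) : ℝ := ∏' n : ℕ, (1 - x * q ^ n)

/-- Gosper's q-sine, as a function of its actual argument `w`
(so `qSin q (π * z)` is `sin_q(π z)` from the paper). -/
noncomputable def qSin (q w : ℝ) : ℝ :=
  q ^ ((w / π - 1 / 2) ^ 2) * qPoch (q ^ (2 * (w / π))) (q ^ 2) *
    qPoch (q ^ (2 - 2 * (w / π))) (q ^ 2) / (qPoch q (q ^ 2)) ^ 2

/-- Gosper's q-cosine, as a function of its actual argument `w`. -/
noncomputable def qCos (q w : ℝ) : ℝ :=
  q ^ ((w / π) ^ 2) * qPoch (q ^ (1 - 2 * (w / π))) (q ^ 2) *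
    qPoch (q ^ (1 + 2 * (w / π))) (q ^ 2) / (qPoch q (q ^ 2)) ^ 2

/-- Gosper's constant `S(q) = q^{-1/4} (q²;q⁴)_∞⁴ / (q;q²)_∞²`. -/
noncomputable def gosperS (q : ℝ) : ℝ :=
  q ^ (-(1 / 4 : ℝ)) * (qPoch (q ^ 2) (q ^ 4)) ^ 4 / (qPoch q (q ^ 2)) ^ 2

/-- The q-Gamma function `Γ_q(z) = ((q;q)_∞ / (q^z;q)_∞) (1-q)^{1-z}`. -/
noncomputable def qGamma (q z : ℝ) : ℝ :=
  qPoch q q / qPoch (q ^ z) q * (1 - q) ^ (1 - z)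

open Filter Topology Finset

/-- The finite `q`-Pochhammer symbol `(x; q)_n = ∏_{k < n} (1 - x q ^ k)`. -/
noncomputable def finQPoch (x q : ℝ) (n : ℕ) : ℝ := ∏ k ∈ range n, (1 - x * q ^ k)

/-- The reciprocal `1 / (q; q)_n`, extended by zero to negative integers `n`. -/
noncomputable def recipQPoch (q : ℝ) : ℤ → ℝ
  | .ofNat n => (finQPoch q q n)⁻¹
  | .negSucc _ => 0

section

variable {q : ℝ}

lemma recipQPoch_natCast (n : ℕ) : recipQPoch q n = (finQPoch q q n)⁻¹ := rfl

lemma recipQPoch_of_neg {n : ℤ} (hn : n < 0) : recipQPoch q n = 0 := by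
  obtain ⟨m, rfl⟩ := Int.eq_negSucc_of_lt_zero hn
  rfl

attribute [irreducible] recipQPoch

lemma summable_norm_neg_mul_pow (hq0 : 0 < q) (hq1 : q < 1) (x : ℝ) :
    Summable fun n : ℕ ↦ ‖-(x * q ^ n)‖ := by
  simpa [abs_mul, abs_of_pos hq0] using (summable_geometric_of_lt_one hq0.le hq1).mul_left |x|

lemma multipliable_one_sub_mul_pow (hq0 : 0 < q) (hq1 : q < 1) (x : ℝ) :
    Multipliable fun n : ℕ ↦ 1 - x * q ^ n := by
  simpa [sub_eq_add_neg] using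
    multipliable_one_add_of_summable (summable_norm_neg_mul_pow hq0 hq1 x)

lemma tendsto_finQPoch (hq0 : 0 < q) (hq1 : q < 1) (x : ℝ) :
    Tendsto (finQPoch x q) atTop (𝓝 (qPoch x q)) :=
  (multipliable_one_sub_mul_pow hq0 hq1 x).hasProd.tendsto_prod_nat

lemma qPoch_ne_zero (hq0 : 0 < q) (hq1 : q < 1) {x : ℝ} (hx0 : 0 ≤ x) (hx1 : x < 1) :
    qPoch x q ≠ 0 := by
  have h := tprod_one_add_ne_zero_of_summable (f := fun n : ℕ ↦ -(x * q ^ n)) (fun n ↦ ?_)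
    (summable_norm_neg_mul_pow hq0 hq1 x)
  · simpa [qPoch, sub_eq_add_neg] using h
  · have : x * q ^ n ≤ x := mul_le_of_le_one_right hx0 (pow_le_one₀ hq0.le hq1.le)
    linarith

lemma qPoch_eq_mul_qPoch_sq (hq0 : 0 < q) (hq1 : q < 1) (x : ℝ) :
    qPoch x q = qPoch x (q ^ 2) * qPoch (x * q) (q ^ 2) := by
  have h0 : 0 < q ^ 2 := by positivity
  have h1 : q ^ 2 < 1 := by nlinarith
  have he := multipliable_one_sub_mul_pow h0 h1 x
  have ho := multipliable_one_sub_mul_pow h0 h1 (x * q)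
  have := tprod_even_mul_odd (f := fun n : ℕ ↦ 1 - x * q ^ n) (he.congr fun n ↦ by rw [pow_mul])
    (ho.congr fun n ↦ by rw [← pow_mul]; ring)
  rw [qPoch, ← this, qPoch, qPoch]
  congr 1 <;> refine tprod_congr fun n ↦ ?_ <;> rw [← pow_mul]
  ring

lemma recipQPoch_sub_one (hq0 : 0 < q) (hq1 : q < 1) (n : ℤ) :
    recipQPoch q (n - 1) = (1 - q ^ n) * recipQPoch q n := by
  obtain hn | rfl | hn := lt_trichotomy n 0
  · simp [recipQPoch_of_neg hn, recipQPoch_of_neg (show n - 1 < 0 by lia)]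
  · simp [recipQPoch_of_neg (show (-1 : ℤ) < 0 by lia)]
  · obtain ⟨m, rfl⟩ : ∃ m : ℕ, n = (m + 1 : ℕ) := ⟨(n - 1).toNat, by lia⟩
    have h : 1 - q * q ^ m ≠ 0 := by
      have := pow_lt_one₀ hq0.le hq1 m.succ_ne_zero
      rw [pow_succ'] at this
      linarith
    rw [show ((m + 1 : ℕ) : ℤ) - 1 = (m : ℕ) by simp, recipQPoch_natCast, recipQPoch_natCast,
      zpow_natCast, finQPoch, finQPoch, prod_range_succ, pow_succ', mul_inv, mul_left_comm,
      mul_inv_cancel₀ h, mul_one]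

lemma tendsto_recipQPoch (hq0 : 0 < q) (hq1 : q < 1) :
    Tendsto (recipQPoch q) atTop (𝓝 (qPoch q q)⁻¹) := by
  have h := (tendsto_finQPoch hq0 hq1 q).inv₀ (qPoch_ne_zero hq0 hq1 hq0.le hq1)
  rw [← Nat.map_cast_int_atTop, tendsto_map'_iff]
  exact h.congr fun n ↦ (recipQPoch_natCast n).symm

lemma exists_norm_recipQPoch_le (hq0 : 0 < q) (hq1 : q < 1) :
    ∃ C, ∀ n, ‖recipQPoch q n‖ ≤ C := by
  have h := (tendsto_finQPoch hq0 hq1 q).inv₀ (qPoch_ne_zero hq0 hq1 hq0.le hq1)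
  obtain ⟨C, hC⟩ := h.norm.bddAbove_range
  have hC' (n : ℕ) : ‖(finQPoch q q n)⁻¹‖ ≤ C := hC ⟨n, rfl⟩
  refine ⟨C, fun n ↦ ?_⟩
  obtain hn | hn := lt_or_ge n 0
  · simpa [recipQPoch_of_neg hn] using (norm_nonneg _).trans (hC' 0)
  · lift n to ℕ using hn
    rw [recipQPoch_natCast]
    exact hC' n

variable {w : ℝ} {t : ℤ → ℝ}

lemma summable_mul_recipQPoch (hq0 : 0 < q) (hq1 : q < 1) (hs : Summable t) (a b : ℤ) :
    Summable fun n ↦ t n * recipQPoch q (b + n) * recipQPoch q (a - n) := by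
  obtain ⟨C, hC⟩ := exists_norm_recipQPoch_le hq0 hq1
  refine Summable.of_norm_bounded (hs.norm.mul_right (C * C)) fun n ↦ ?_
  rw [norm_mul, norm_mul, mul_assoc]
  have := (norm_nonneg _).trans (hC 0)
  gcongr <;> exact hC _

lemma tsum_mul_recipQPoch_succ_left (hq0 : 0 < q) (hq1 : q < 1) (hs : Summable t)
    (ht : ∀ n, t (n + 1) = -(q ^ n * w) * t n) (a b : ℤ) :
    (∑' n, t n * recipQPoch q (b + n) * recipQPoch q (a - n)) * (1 - w * q ^ a) =
      (1 - q ^ (a + b + 1)) *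
        ∑' n, t n * recipQPoch q (b + n) * recipQPoch q (a + 1 - n) := by
  set f : ℤ → ℝ := fun n ↦ t n * recipQPoch q (b + n) * recipQPoch q (a - n)
  have hf : Summable f := summable_mul_recipQPoch hq0 hq1 hs a b
  have hf' : Summable fun n ↦ f (n - 1) := (Equiv.subRight (1 : ℤ)).summable_iff.2 hf
  have hshift : ∑' n, f (n - 1) = ∑' n, f n := (Equiv.subRight (1 : ℤ)).tsum_eq f
  calc (∑' n, f n) * (1 - w * q ^ a) = ∑' n, (f n - f (n - 1) * (w * q ^ a)) := by
        rw [hf.tsum_sub (hf'.mul_right _), tsum_mul_right, hshift]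
        ring
    _ = _ := by
        rw [← tsum_mul_left]
        refine tsum_congr fun n ↦ ?_
        have h1 := recipQPoch_sub_one hq0 hq1 (a + 1 - n)
        have h2 := recipQPoch_sub_one hq0 hq1 (b + n)
        have h3 := ht (n - 1)
        rw [sub_add_cancel] at h3
        simp only [f]
        rw [show a - (n - 1) = a + 1 - n by ring, show b + (n - 1) = b + n - 1 by ring,
          show a - n = a + 1 - n - 1 by ring, h1, h2, h3]
        have e1 : q ^ a = q ^ (a + 1 - n) * q ^ (n - 1) := by
          rw [← zpow_add₀ hq0.ne']; congr 1; ring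
        have e2 : q ^ (a + b + 1) = q ^ (a + 1 - n) * q ^ (b + n) := by
          rw [← zpow_add₀ hq0.ne']; congr 1; ring
        rw [e1, e2]
        ring

lemma tsum_mul_recipQPoch_succ_right (hq0 : 0 < q) (hq1 : q < 1) (hw : w ≠ 0) (hs : Summable t)
    (ht : ∀ n, t (n + 1) = -(q ^ n * w) * t n) (a b : ℤ) :
    (∑' n, t n * recipQPoch q (b + n) * recipQPoch q (a - n)) * (1 - q / w * q ^ b) =
      (1 - q ^ (a + b + 1)) *
        ∑' n, t n * recipQPoch q (b + 1 + n) * recipQPoch q (a - n) := by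
  set f : ℤ → ℝ := fun n ↦ t n * recipQPoch q (b + n) * recipQPoch q (a - n)
  have hf : Summable f := summable_mul_recipQPoch hq0 hq1 hs a b
  have hf' : Summable fun n ↦ f (n + 1) := (Equiv.addRight (1 : ℤ)).summable_iff.2 hf
  have hshift : ∑' n, f (n + 1) = ∑' n, f n := (Equiv.addRight (1 : ℤ)).tsum_eq f
  calc (∑' n, f n) * (1 - q / w * q ^ b) = ∑' n, (f n - f (n + 1) * (q / w * q ^ b)) := by
        rw [hf.tsum_sub (hf'.mul_right _), tsum_mul_right, hshift]
        ring
    _ = _ := by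
        rw [← tsum_mul_left]
        refine tsum_congr fun n ↦ ?_
        have h1 := recipQPoch_sub_one hq0 hq1 (b + 1 + n)
        have h2 := recipQPoch_sub_one hq0 hq1 (a - n)
        simp only [f]
        rw [show a - (n + 1) = a - n - 1 by ring, show b + (n + 1) = b + 1 + n by ring,
          show b + n = b + 1 + n - 1 by ring, h1, h2, ht]
        have e1 : q ^ n * w * (q / w * q ^ b) = q ^ (b + 1 + n) := by
          rw [zpow_add₀ hq0.ne', zpow_add_one₀ hq0.ne']
          field_simp
        have e2 : q ^ (a + b + 1) = q ^ (a - n) * q ^ (b + 1 + n) := by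
          rw [← zpow_add₀ hq0.ne']; congr 1; ring
        rw [e2]
        linear_combination t n * recipQPoch q (b + 1 + n) *
          ((1 - q ^ (a - n)) * recipQPoch q (a - n)) * e1

/-- The finite form of the Jacobi triple product identity. -/
lemma finQPoch_mul_finQPoch_eq_tsum (hq0 : 0 < q) (hq1 : q < 1) (hw : w ≠ 0) (hs : Summable t)
    (h0 : t 0 = 1) (ht : ∀ n, t (n + 1) = -(q ^ n * w) * t n) (N : ℕ) :
    finQPoch w q N * finQPoch (q / w) q N = finQPoch q q (2 * N) *
      ∑' n, t n * recipQPoch q (N + n) * recipQPoch q (N - n) := by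
  induction N with
  | zero =>
    rw [tsum_eq_single 0]
    · have h : recipQPoch q 0 = 1 := by simpa [finQPoch] using recipQPoch_natCast (q := q) 0
      simp [h0, h, finQPoch]
    · intro n hn
      obtain hn | hn := hn.lt_or_gt
      · simp [recipQPoch_of_neg hn]
      · simp [recipQPoch_of_neg (neg_lt_zero.2 hn)]
  | succ N ih =>
    have hl := tsum_mul_recipQPoch_succ_left hq0 hq1 hs ht N N
    have hr := tsum_mul_recipQPoch_succ_right hq0 hq1 hw hs ht (N + 1) N
    have e1 : q ^ ((N : ℤ) + N + 1) = q * q ^ (2 * N) := by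
      rw [← pow_succ', ← zpow_natCast]; congr 1; push_cast; ring
    have e2 : q ^ ((N : ℤ) + 1 + N + 1) = q * q ^ (2 * N + 1) := by
      rw [← pow_succ', ← zpow_natCast]; congr 1; push_cast; ring
    rw [e1, zpow_natCast] at hl
    rw [e2, zpow_natCast] at hr
    have step (x : ℝ) (n : ℕ) : finQPoch x q (n + 1) = finQPoch x q n * (1 - x * q ^ n) :=
      prod_range_succ _ _
    rw [mul_add, mul_one, step w, step (q / w), step q (2 * N + 1), step q (2 * N)]
    push_cast
    linear_combination (1 - w * q ^ N) * (1 - q / w * q ^ N) * ih +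
      finQPoch q q (2 * N) * (1 - q / w * q ^ N) * hl +
      finQPoch q q (2 * N) * (1 - q * q ^ (2 * N)) * hr

/-- The Jacobi triple product identity, for any summable `t` satisfying the recurrence of
`n ↦ (-1) ^ n * q ^ (n * (n - 1) / 2) * w ^ n`. -/
theorem tsum_eq_qPoch_mul_qPoch_mul_qPoch (hq0 : 0 < q) (hq1 : q < 1) (hw : w ≠ 0)
    (hs : Summable t) (h0 : t 0 = 1) (ht : ∀ n, t (n + 1) = -(q ^ n * w) * t n) :
    ∑' n, t n = qPoch q q * qPoch w q * qPoch (q / w) q := by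
  have hne := qPoch_ne_zero hq0 hq1 hq0.le hq1
  have hR := tendsto_recipQPoch hq0 hq1
  obtain ⟨C, hC⟩ := exists_norm_recipQPoch_le hq0 hq1
  have hC0 := (norm_nonneg _).trans (hC 0)
  have hsum : Tendsto (fun N : ℕ ↦ ∑' n, t n * recipQPoch q (N + n) * recipQPoch q (N - n)) atTop
      (𝓝 (∑' n, t n * (qPoch q q)⁻¹ * (qPoch q q)⁻¹)) := by
    refine tendsto_tsum_of_dominated_convergence (hs.norm.mul_right (C * C)) (fun n ↦ ?_)
      (.of_forall fun N n ↦ ?_)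
    · have hcast : Tendsto (fun N : ℕ ↦ (N : ℤ)) atTop atTop := tendsto_natCast_atTop_atTop
      exact ((hR.comp (tendsto_atTop_add_const_right _ n hcast)).const_mul _).mul
        (hR.comp (tendsto_atTop_add_const_right _ (-n) hcast))
    · rw [norm_mul, norm_mul, mul_assoc]
      gcongr <;> exact hC _
  have h2 : Tendsto (fun N : ℕ ↦ 2 * N) atTop atTop := tendsto_id.const_mul_atTop' two_pos
  have hlim := ((tendsto_finQPoch hq0 hq1 q).comp h2).mul hsum
  have key := tendsto_nhds_unique
    (((tendsto_finQPoch hq0 hq1 w).mul (tendsto_finQPoch hq0 hq1 (q / w))).congr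
      (finQPoch_mul_finQPoch_eq_tsum hq0 hq1 hw hs h0 ht)) hlim
  rw [tsum_mul_right, tsum_mul_right] at key
  rw [mul_assoc, key]
  field_simp

lemma summable_neg_one_zpow_mul_rpow (hq0 : 0 < q) (hq1 : q < 1) (y : ℝ) :
    Summable fun n : ℤ ↦ (-1 : ℝ) ^ n * q ^ ((n : ℝ) ^ 2 + y * n) := by
  have him : 0 < (⟨0, -log q / π⟩ : ℂ).im := div_pos (neg_pos.2 (log_neg hq0 hq1)) pi_pos
  have h := ((summable_jacobiTheta₂_term_iff ⟨0, -(y * log q) / (2 * π)⟩ _).2 him).norm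
  refine Summable.of_norm (h.congr fun n ↦ ?_)
  rw [norm_jacobiTheta₂_term, norm_mul, norm_zpow, norm_neg, norm_one, one_zpow, one_mul,
    norm_of_nonneg (by positivity), rpow_def_of_pos hq0]
  congr 1
  field_simp
  ring

end

/-- `i * theta1 (i z ln q, q)` equals
`q^(-z^2) * ((q;q)^2 / (q^2;q^2)) * sin_q(pi z)`,
stated as the equivalent identity of real numbers. -/
theorem theta_eq_qSin (q z : ℝ) (hq0 : 0 < q) (hq1 : q < 1) :
    ∑' n : ℤ, (-1 : ℝ) ^ n * q ^ (((n : ℝ) + 1 / 2) ^ 2) * q ^ (-((2 * (n : ℝ) + 1) * z)) =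
      q ^ (-z ^ 2) * ((qPoch q q) ^ 2 / qPoch (q ^ 2) (q ^ 2)) * qSin q (π * z) := by
  have hp0 : 0 < q ^ 2 := by positivity
  have hp1 : q ^ 2 < 1 := by nlinarith
  have hw : q ^ (2 - 2 * z) ≠ 0 := (rpow_pos_of_pos hq0 _).ne'
  have htriple := tsum_eq_qPoch_mul_qPoch_mul_qPoch hp0 hp1 hw
    (summable_neg_one_zpow_mul_rpow hq0 hq1 (1 - 2 * z)) (by simp) fun n ↦ by
      rw [← rpow_intCast (q ^ 2), ← rpow_natCast q 2, ← rpow_mul hq0.le, ← rpow_add hq0,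
        zpow_add_one₀ (by norm_num)]
      have : q ^ (((n + 1 : ℤ) : ℝ) ^ 2 + (1 - 2 * z) * ((n + 1 : ℤ) : ℝ)) =
          q ^ (((2 : ℕ) : ℝ) * n + (2 - 2 * z)) * q ^ ((n : ℝ) ^ 2 + (1 - 2 * z) * n) := by
        rw [← rpow_add hq0]
        congr 1
        push_cast
        ring
      rw [this]
      ring
  have hdiv : q ^ 2 / q ^ (2 - 2 * z) = q ^ (2 * z) := by
    rw [← rpow_natCast q 2, ← rpow_sub hq0]
    congr 1
    push_cast
    ring
  have hterm (n : ℤ) : (-1 : ℝ) ^ n * q ^ (((n : ℝ) + 1 / 2) ^ 2) *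
      q ^ (-((2 * (n : ℝ) + 1) * z)) =
      q ^ (1 / 4 - z) * ((-1 : ℝ) ^ n * q ^ ((n : ℝ) ^ 2 + (1 - 2 * z) * n)) := by
    rw [mul_assoc, ← rpow_add hq0, mul_left_comm, ← rpow_add hq0]
    congr 2
    ring
  have hexp : q ^ (1 / 4 - z) = q ^ (-z ^ 2) * q ^ ((z - 1 / 2) ^ 2) := by
    rw [← rpow_add hq0]
    congr 1
    ring
  have h1 := qPoch_ne_zero hp0 hp1 hq0.le hq1
  have h2 := qPoch_ne_zero hp0 hp1 hp0.le hp1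
  rw [tsum_congr hterm, tsum_mul_left, htriple, hdiv, hexp, qSin, mul_div_cancel_left₀ _ pi_ne_zero,
    qPoch_eq_mul_qPoch_sq hq0 hq1 q, ← pow_two]
  field_simp
end

section
/- Let 0 < q < 1 and suppose Gosper's duplication formulas hold for the parameter q, i.e. sin_q(2z) = S(q)·sin_{q²}(z)·cos_{q²}(z) and cos_q(2z) = cos_{q²}(z)² − sin_{q²}(z)² for all real z. Then i·ϑ₁((1/4) i ln q, q) = (√q;q)_∞ (q;q)_∞² / ((q;q²)_∞² (q²;q²)_∞). Equivalently, ∑_{n∈ℤ} (−1)ⁿ q^{(n+1/2)²} q^{−(2n+1)/4} = (√q;q)_∞ (q;q)_∞² / ((q;q²)_∞² (q²;q²)_∞). -/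
open Real

open Finset Filter Topology

/-- The finite product `(x; x)_m = ∏_{k=1}^m (1 - x ^ k)`. -/
noncomputable def eulerProd (x : ℝ) (m : ℕ) : ℝ := ∏ k ∈ range m, (1 - x ^ (k + 1))

/-- The reciprocal of `(x; x)_m`, extended by zero to negative `m`. -/
noncomputable def invEulerProd (x : ℝ) (m : ℤ) : ℝ :=
  if 0 ≤ m then (eulerProd x m.toNat)⁻¹ else 0

lemma one_sub_pow_succ_pos {x : ℝ} (hx0 : 0 < x) (hx1 : x < 1) (k : ℕ) : 0 < 1 - x ^ (k + 1) :=
  sub_pos.2 (pow_lt_one₀ hx0.le hx1 k.succ_ne_zero)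

lemma eulerProd_pos {x : ℝ} (hx0 : 0 < x) (hx1 : x < 1) (m : ℕ) : 0 < eulerProd x m :=
  prod_pos fun k _ ↦ one_sub_pow_succ_pos hx0 hx1 k

lemma eulerProd_le_one {x : ℝ} (hx0 : 0 < x) (hx1 : x < 1) (m : ℕ) : eulerProd x m ≤ 1 :=
  prod_le_one (fun k _ ↦ (one_sub_pow_succ_pos hx0 hx1 k).le)
    fun _ _ ↦ sub_le_self _ (pow_pos hx0 _).le

lemma eulerProd_succ (x : ℝ) (m : ℕ) : eulerProd x (m + 1) = eulerProd x m * (1 - x ^ (m + 1)) :=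
  prod_range_succ _ _

lemma eulerProd_antitone {x : ℝ} (hx0 : 0 < x) (hx1 : x < 1) : Antitone (eulerProd x) := by
  refine antitone_nat_of_succ_le fun m ↦ ?_
  rw [eulerProd_succ]
  exact mul_le_of_le_one_right (eulerProd_pos hx0 hx1 m).le (sub_le_self _ (pow_pos hx0 _).le)

lemma summable_norm_const_mul_pow {x : ℝ} (hx0 : 0 < x) (hx1 : x < 1) (c : ℝ) :
    Summable fun k : ℕ ↦ ‖c * x ^ k‖ :=
  ((summable_geometric_of_lt_one hx0.le hx1).mul_left c).norm

lemma multipliable_one_sub_mul_pow_s1 {x : ℝ} (hx0 : 0 < x) (hx1 : x < 1) (c : ℝ) :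
    Multipliable fun k : ℕ ↦ 1 - c * x ^ k := by
  simpa [sub_eq_add_neg] using
    multipliable_one_add_of_summable (summable_norm_const_mul_pow hx0 hx1 (-c))

lemma hasProd_qPoch {x : ℝ} (hx0 : 0 < x) (hx1 : x < 1) (c : ℝ) :
    HasProd (fun k : ℕ ↦ 1 - c * x ^ k) (qPoch c x) :=
  (multipliable_one_sub_mul_pow_s1 hx0 hx1 c).hasProd

lemma qPoch_ne_zero_s1 {x c : ℝ} (hx0 : 0 < x) (hx1 : x < 1) (hc0 : 0 ≤ c) (hc1 : c < 1) :
    qPoch c x ≠ 0 := by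
  have h := tprod_one_add_ne_zero_of_summable (f := fun k : ℕ ↦ -c * x ^ k) (fun k ↦ ?_)
    (summable_norm_const_mul_pow hx0 hx1 (-c))
  · simpa [qPoch, sub_eq_add_neg] using h
  · have : c * x ^ k < 1 :=
      (mul_le_of_le_one_right hc0 (pow_le_one₀ hx0.le hx1.le)).trans_lt hc1
    linarith

lemma tendsto_eulerProd {x : ℝ} (hx0 : 0 < x) (hx1 : x < 1) :
    Tendsto (eulerProd x) atTop (𝓝 (qPoch x x)) := by
  have h := (hasProd_qPoch hx0 hx1 x).tendsto_prod_nat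
  simp only [← pow_succ'] at h
  exact h

lemma qPoch_self_pos {x : ℝ} (hx0 : 0 < x) (hx1 : x < 1) : 0 < qPoch x x :=
  (ge_of_tendsto' (tendsto_eulerProd hx0 hx1) fun m ↦ (eulerProd_pos hx0 hx1 m).le).lt_of_ne'
    (qPoch_ne_zero_s1 hx0 hx1 hx0.le hx1)

lemma qPoch_self_le_eulerProd {x : ℝ} (hx0 : 0 < x) (hx1 : x < 1) (m : ℕ) :
    qPoch x x ≤ eulerProd x m :=
  (eulerProd_antitone hx0 hx1).le_of_tendsto (tendsto_eulerProd hx0 hx1) m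

lemma invEulerProd_sub_one {x : ℝ} (hx0 : 0 < x) (hx1 : x < 1) (m : ℤ) :
    invEulerProd x (m - 1) = (1 - x ^ m) * invEulerProd x m := by
  rcases lt_trichotomy m 0 with h | rfl | h
  · simp [invEulerProd, h.not_ge, show ¬ 1 ≤ m by lia]
  · simp [invEulerProd]
  · obtain ⟨k, rfl⟩ : ∃ k : ℕ, m = k + 1 := ⟨(m - 1).toNat, by lia⟩
    have h1 := (eulerProd_pos hx0 hx1 k).ne'
    have h2 := (one_sub_pow_succ_pos hx0 hx1 k).ne'
    have h3 : x ^ ((k : ℤ) + 1) = x ^ (k + 1) := by exact_mod_cast zpow_natCast x (k + 1)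
    rw [invEulerProd, invEulerProd, if_pos (by lia), if_pos (by lia), h3,
      show ((k : ℤ) + 1 - 1).toNat = k by lia, show ((k : ℤ) + 1).toNat = k + 1 by lia,
      eulerProd_succ]
    field_simp

lemma invEulerProd_nonneg {x : ℝ} (hx0 : 0 < x) (hx1 : x < 1) (m : ℤ) :
    0 ≤ invEulerProd x m := by
  unfold invEulerProd
  split_ifs
  · exact (inv_pos.2 (eulerProd_pos hx0 hx1 _)).le
  · exact le_rfl

lemma invEulerProd_le {x : ℝ} (hx0 : 0 < x) (hx1 : x < 1) (m : ℤ) :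
    invEulerProd x m ≤ (qPoch x x)⁻¹ := by
  unfold invEulerProd
  split_ifs
  · exact inv_anti₀ (qPoch_self_pos hx0 hx1) (qPoch_self_le_eulerProd hx0 hx1 _)
  · exact (inv_pos.2 (qPoch_self_pos hx0 hx1)).le

lemma tendsto_invEulerProd {x : ℝ} (hx0 : 0 < x) (hx1 : x < 1) :
    Tendsto (invEulerProd x) atTop (𝓝 (qPoch x x)⁻¹) := by
  have h : Tendsto Int.toNat atTop atTop :=
    tendsto_atTop.2 fun b ↦ (eventually_ge_atTop (b : ℤ)).mono fun m hm ↦ by lia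
  refine (((tendsto_eulerProd hx0 hx1).comp h).inv₀ (qPoch_self_pos hx0 hx1).ne').congr' ?_
  filter_upwards [eventually_ge_atTop 0] with m hm
  simp [invEulerProd, hm]

/-- The coefficient of `t ^ n` in the finite Jacobi triple product with `N` factors. -/
noncomputable def finiteTripleCoeff (q : ℝ) (N : ℕ) (n : ℤ) : ℝ :=
  q ^ (n ^ 2) * eulerProd (q ^ 2) (2 * N) *
    (invEulerProd (q ^ 2) (N + n) * invEulerProd (q ^ 2) (N - n))

lemma finiteTripleCoeff_succ {q : ℝ} (hq0 : 0 < q) (hq1 : q < 1) (N : ℕ) (n : ℤ) :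
    finiteTripleCoeff q (N + 1) n =
      (1 + q ^ (2 * (2 * N + 1))) * finiteTripleCoeff q N n +
        q ^ (2 * N + 1) * (finiteTripleCoeff q N (n - 1) + finiteTripleCoeff q N (n + 1)) := by
  have hx0 : 0 < q ^ 2 := by positivity
  have hx1 : q ^ 2 < 1 := pow_lt_one₀ hq0.le hq1 two_ne_zero
  have hr := invEulerProd_sub_one hx0 hx1
  have hq := hq0.ne'
  set A : ℝ := (q ^ 2) ^ ((N : ℤ) + n + 1) with hA
  set B : ℝ := (q ^ 2) ^ ((N : ℤ) - n + 1) with hB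
  have hA' : (q ^ 2) ^ ((N : ℤ) + n) = A / q ^ 2 := by
    rw [hA, zpow_add_one₀ hx0.ne']; field_simp
  have hB' : (q ^ 2) ^ ((N : ℤ) - n) = B / q ^ 2 := by
    rw [hB, zpow_add_one₀ hx0.ne']; field_simp
  have hAB : A * B = q ^ (4 * N + 4) := by
    rw [hA, hB, ← zpow_add₀ hx0.ne', ← zpow_natCast q 2, ← zpow_mul, ← zpow_natCast]
    congr 1; push_cast; ring
  have hm : q ^ (2 * N + 1) * q ^ ((n - 1) ^ 2) = q ^ (n ^ 2) * B := by
    rw [hB, ← zpow_natCast q 2, ← zpow_mul, ← zpow_natCast q (2 * N + 1), ← zpow_add₀ hq,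
      ← zpow_add₀ hq]
    congr 1; push_cast; ring
  have hp : q ^ (2 * N + 1) * q ^ ((n + 1) ^ 2) = q ^ (n ^ 2) * A := by
    rw [hA, ← zpow_natCast q 2, ← zpow_mul, ← zpow_natCast q (2 * N + 1), ← zpow_add₀ hq,
      ← zpow_add₀ hq]
    congr 1; push_cast; ring
  have a1 := hr (N + n + 1)
  have a2 := hr (N + n)
  have b1 := hr (N - n + 1)
  have b2 := hr (N - n)
  rw [add_sub_cancel_right] at a1 b1
  rw [a1, hA'] at a2
  rw [b1, hB'] at b2
  have e : eulerProd (q ^ 2) (2 * (N + 1)) =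
      eulerProd (q ^ 2) (2 * N) * (1 - A * B / q ^ 2) * (1 - A * B) := by
    rw [mul_add_one, eulerProd_succ, eulerProd_succ, hAB]
    congr 2
    · field_simp; ring
    · ring
  have hpow : q ^ (2 * (2 * N + 1)) = A * B / q ^ 2 := by
    rw [hAB]; field_simp; ring
  rw [mul_add (q ^ (2 * N + 1))]
  simp only [finiteTripleCoeff, e, hpow, ← mul_assoc, hm, hp]
  push_cast
  rw [show (N : ℤ) + 1 + n = N + n + 1 by ring, show (N : ℤ) + 1 - n = N - n + 1 by ring,
    show (N : ℤ) + (n - 1) = N + n - 1 by ring, show (N : ℤ) - (n - 1) = N - n + 1 by ring,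
    show (N : ℤ) + (n + 1) = N + n + 1 by ring, show (N : ℤ) - (n + 1) = N - n - 1 by ring,
    a1, a2, b1, b2]
  field_simp
  ring

/-- The finite form of the Jacobi triple product identity. -/
lemma hasSum_finiteTripleCoeff {q t : ℝ} (hq0 : 0 < q) (hq1 : q < 1) (ht : t ≠ 0) (N : ℕ) :
    HasSum (fun n : ℤ ↦ finiteTripleCoeff q N n * t ^ n)
      (∏ k ∈ range N, ((1 + t * q ^ (2 * k + 1)) * (1 + t⁻¹ * q ^ (2 * k + 1)))) := by
  induction N with
  | zero =>
    convert hasSum_single (f := fun n : ℤ ↦ finiteTripleCoeff q 0 n * t ^ n) 0 ?_ using 1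
    · simp [finiteTripleCoeff, invEulerProd, eulerProd]
    · intro n hn
      rcases lt_or_gt_of_ne hn with h | h
      · simp [finiteTripleCoeff, invEulerProd, h.not_ge]
      · simp [finiteTripleCoeff, invEulerProd, h.not_ge]
  | succ N ih =>
    have h1 := ((Equiv.subRight (1 : ℤ)).hasSum_iff.2 ih).mul_left t
    have h2 := ((Equiv.addRight (1 : ℤ)).hasSum_iff.2 ih).mul_left t⁻¹
    have h := (ih.mul_left (1 + q ^ (2 * (2 * N + 1)))).add
      ((h1.add h2).mul_left (q ^ (2 * N + 1)))
    have hprod : ∏ k ∈ range (N + 1), ((1 + t * q ^ (2 * k + 1)) * (1 + t⁻¹ * q ^ (2 * k + 1))) =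
        (1 + q ^ (2 * (2 * N + 1))) *
            ∏ k ∈ range N, ((1 + t * q ^ (2 * k + 1)) * (1 + t⁻¹ * q ^ (2 * k + 1))) +
          q ^ (2 * N + 1) *
            (t * ∏ k ∈ range N, ((1 + t * q ^ (2 * k + 1)) * (1 + t⁻¹ * q ^ (2 * k + 1))) +
              t⁻¹ * ∏ k ∈ range N, ((1 + t * q ^ (2 * k + 1)) * (1 + t⁻¹ * q ^ (2 * k + 1)))) := by
      rw [prod_range_succ]
      field_simp
      ring
    have hcoeff (n : ℤ) : finiteTripleCoeff q (N + 1) n * t ^ n =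
        (1 + q ^ (2 * (2 * N + 1))) * (finiteTripleCoeff q N n * t ^ n) +
          q ^ (2 * N + 1) * (t * (finiteTripleCoeff q N (n - 1) * t ^ (n - 1)) +
            t⁻¹ * (finiteTripleCoeff q N (n + 1) * t ^ (n + 1))) := by
      rw [finiteTripleCoeff_succ hq0 hq1, zpow_sub_one₀ ht, zpow_add_one₀ ht]
      field_simp
    simp only [hprod, hcoeff]
    exact h

lemma abs_finiteTripleCoeff_le {q : ℝ} (hq0 : 0 < q) (hq1 : q < 1) (N : ℕ) (n : ℤ) :
    |finiteTripleCoeff q N n| ≤ q ^ (n ^ 2) * ((qPoch (q ^ 2) (q ^ 2))⁻¹) ^ 2 := by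
  have hx0 : 0 < q ^ 2 := by positivity
  have hx1 : q ^ 2 < 1 := pow_lt_one₀ hq0.le hq1 two_ne_zero
  have hz : 0 < q ^ (n ^ 2) := zpow_pos hq0 _
  have h1 := invEulerProd_nonneg hx0 hx1
  have h2 := invEulerProd_le hx0 hx1
  have h3 := (eulerProd_pos hx0 hx1 (2 * N)).le
  rw [finiteTripleCoeff, abs_of_nonneg
    (mul_nonneg (mul_nonneg hz.le h3) (mul_nonneg (h1 _) (h1 _))), sq (qPoch _ _)⁻¹]
  exact mul_le_mul (mul_le_of_le_one_right hz.le (eulerProd_le_one hx0 hx1 _))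
    (mul_le_mul (h2 _) (h2 _) (h1 _) ((h1 0).trans (h2 0))) (mul_nonneg (h1 _) (h1 _)) hz.le

lemma tendsto_finiteTripleCoeff {q : ℝ} (hq0 : 0 < q) (hq1 : q < 1) (n : ℤ) :
    Tendsto (finiteTripleCoeff q · n) atTop (𝓝 (q ^ (n ^ 2) * (qPoch (q ^ 2) (q ^ 2))⁻¹)) := by
  have hx0 : 0 < q ^ 2 := by positivity
  have hx1 : q ^ 2 < 1 := pow_lt_one₀ hq0.le hq1 two_ne_zero
  have hE := (qPoch_self_pos hx0 hx1).ne'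
  have h1 : Tendsto (fun N : ℕ ↦ (N : ℤ) + n) atTop atTop :=
    tendsto_atTop_add_const_right _ n tendsto_natCast_atTop_atTop
  have h2 : Tendsto (fun N : ℕ ↦ (N : ℤ) - n) atTop atTop :=
    tendsto_atTop_add_const_right _ (-n) tendsto_natCast_atTop_atTop
  have h3 : Tendsto (fun N : ℕ ↦ 2 * N) atTop atTop :=
    tendsto_id.const_mul_atTop' two_pos
  have hr := tendsto_invEulerProd hx0 hx1
  have := (((tendsto_eulerProd hx0 hx1).comp h3).const_mul (q ^ (n ^ 2))).mul
    ((hr.comp h1).mul (hr.comp h2))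
  rw [mul_assoc (q ^ (n ^ 2)), mul_inv_cancel_left₀ hE] at this
  exact this

lemma summable_zpow_sq_mul_zpow {q s : ℝ} (hq0 : 0 < q) (hq1 : q < 1) (hs : 0 < s) :
    Summable fun n : ℤ ↦ q ^ (n ^ 2) * s ^ n := by
  have him : 0 < (⟨0, -log q / π⟩ : ℂ).im := div_pos (neg_pos.2 (log_neg hq0 hq1)) pi_pos
  have h := ((summable_jacobiTheta₂_term_iff ⟨0, -log s / (2 * π)⟩ _).2 him).norm
  refine h.congr fun n ↦ ?_
  rw [norm_jacobiTheta₂_term]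
  have e1 : q ^ (n ^ 2) = exp (log q * (n : ℝ) ^ 2) := by
    rw [← rpow_intCast, rpow_def_of_pos hq0]; push_cast; rfl
  have e2 : s ^ n = exp (log s * n) := by
    rw [← rpow_intCast, rpow_def_of_pos hs]
  rw [e1, e2, ← exp_add]
  congr 1
  field_simp
  ring

/-- The Jacobi triple product identity for real parameters. -/
theorem tsum_zpow_sq_mul_zpow {q t : ℝ} (hq0 : 0 < q) (hq1 : q < 1) (ht : t ≠ 0) :
    ∑' n : ℤ, q ^ (n ^ 2) * t ^ n =
      qPoch (q ^ 2) (q ^ 2) * (qPoch (-(t * q)) (q ^ 2) * qPoch (-(t⁻¹ * q)) (q ^ 2)) := by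
  have hx0 : 0 < q ^ 2 := by positivity
  have hx1 : q ^ 2 < 1 := pow_lt_one₀ hq0.le hq1 two_ne_zero
  have hE := (qPoch_self_pos hx0 hx1).ne'
  have hlim : Tendsto (fun N ↦ ∑' n : ℤ, finiteTripleCoeff q N n * t ^ n) atTop
      (𝓝 (∑' n : ℤ, q ^ (n ^ 2) * (qPoch (q ^ 2) (q ^ 2))⁻¹ * t ^ n)) := by
    refine tendsto_tsum_of_dominated_convergence
      ((summable_zpow_sq_mul_zpow hq0 hq1 (abs_pos.2 ht)).mul_left
        (((qPoch (q ^ 2) (q ^ 2))⁻¹) ^ 2))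
      (fun n ↦ (tendsto_finiteTripleCoeff hq0 hq1 n).mul_const _)
      (.of_forall fun N n ↦ ?_)
    rw [norm_mul, norm_zpow, norm_eq_abs, norm_eq_abs]
    calc _ ≤ q ^ (n ^ 2) * ((qPoch (q ^ 2) (q ^ 2))⁻¹) ^ 2 * |t| ^ n :=
          mul_le_mul_of_nonneg_right (abs_finiteTripleCoeff_le hq0 hq1 N n)
            (zpow_nonneg (abs_nonneg t) n)
      _ = _ := by ring
  have hprod := ((hasProd_qPoch hx0 hx1 (-(t * q))).mul
    (hasProd_qPoch hx0 hx1 (-(t⁻¹ * q)))).tendsto_prod_nat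
  have key := tendsto_nhds_unique (hlim.congr fun N ↦ ?_) hprod
  · rw [← key, ← tsum_mul_left]
    exact tsum_congr fun n ↦ by field_simp
  · rw [(hasSum_finiteTripleCoeff hq0 hq1 ht N).tsum_eq]
    exact prod_congr rfl fun k _ ↦ by ring

/-- Splitting `(x; q)_∞` into its even and odd factors. -/
lemma qPoch_eq_mul {q : ℝ} (hq0 : 0 < q) (hq1 : q < 1) (x : ℝ) :
    qPoch x q = qPoch x (q ^ 2) * qPoch (x * q) (q ^ 2) := by
  have hx0 : 0 < q ^ 2 := by positivity
  have hx1 : q ^ 2 < 1 := pow_lt_one₀ hq0.le hq1 two_ne_zero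
  refine (HasProd.even_mul_odd ?_ ?_).tprod_eq
  · simpa only [pow_mul] using hasProd_qPoch hx0 hx1 x
  · convert hasProd_qPoch hx0 hx1 (x * q) using 3 with k
    ring

/-- assuming Gosper's duplication formulas, the theta value identity,
stated as the equivalent identity of real numbers. -/
theorem theta_special_value (q : ℝ) (hq0 : 0 < q) (hq1 : q < 1)
    (hsin : ∀ z : ℝ, qSin q (2 * z) = gosperS q * qSin (q ^ 2) z * qCos (q ^ 2) z)
    (hcos : ∀ z : ℝ, qCos q (2 * z) = qCos (q ^ 2) z ^ 2 - qSin (q ^ 2) z ^ 2) :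
    ∑' n : ℤ, (-1 : ℝ) ^ n * q ^ (((n : ℝ) + 1 / 2) ^ 2) * q ^ (-((2 * (n : ℝ) + 1) / 4)) =
      qPoch (Real.sqrt q) q * (qPoch q q) ^ 2 /
        ((qPoch q (q ^ 2)) ^ 2 * qPoch (q ^ 2) (q ^ 2)) := by
  have hs : 0 < √q := sqrt_pos.2 hq0
  have hsq : √q * √q = q := mul_self_sqrt hq0.le
  have hx0 : 0 < q ^ 2 := by positivity
  have hx1 : q ^ 2 < 1 := pow_lt_one₀ hq0.le hq1 two_ne_zero
  have h1 := qPoch_ne_zero_s1 hx0 hx1 hq0.le hq1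
  have h2 := qPoch_ne_zero_s1 hx0 hx1 hx0.le hx1
  have hterm (n : ℤ) : (-1 : ℝ) ^ n * q ^ (((n : ℝ) + 1 / 2) ^ 2) *
      q ^ (-((2 * (n : ℝ) + 1) / 4)) = q ^ (n ^ 2) * (-√q) ^ n := by
    rw [neg_eq_neg_one_mul √q, mul_zpow, mul_assoc, ← rpow_add hq0, sqrt_eq_rpow,
      ← rpow_intCast q, ← rpow_intCast (q ^ (1 / 2 : ℝ)), ← rpow_mul hq0.le,
      mul_left_comm, ← rpow_add hq0]
    congr 2
    push_cast
    ring
  have hinv : -((-√q)⁻¹ * q) = √q := by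
    field_simp
    linarith
  rw [tsum_congr hterm, tsum_zpow_sq_mul_zpow hq0 hq1 (neg_ne_zero.2 hs.ne'), hinv,
    neg_mul, neg_neg, qPoch_eq_mul hq0 hq1 √q, qPoch_eq_mul hq0 hq1 q, ← sq q]
  field_simp
end

section
/- For every real q with 0 < q < 1 and every real z, sin_q(πz) = q^{1/4} · Γ_{q²}(1/2)² · (q²)^{z(z−1)/2} / (Γ_{q²}(z) · Γ_{q²}(1−z)). -/
open Real

theorem qPoch_self_ne_zero {q : ℝ} (hq0 : 0 < q) (hq1 : q < 1) : qPoch q q ≠ 0 := by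
  have hsum : Summable fun n : ℕ => ‖-(q * q ^ n)‖ := by
    simpa [abs_of_pos hq0] using (summable_geometric_of_lt_one hq0.le hq1).mul_left q
  have h := tprod_one_add_ne_zero_of_summable (f := fun n : ℕ => -(q * q ^ n)) (fun n => ?_) hsum
  · simpa only [qPoch, sub_eq_add_neg] using h
  · have : q ^ (n + 1) < 1 := pow_lt_one₀ hq0.le hq1 n.succ_ne_zero
    rw [← sub_eq_add_neg, ← pow_succ']
    exact (sub_pos.mpr this).ne'

/-- Gosper's q-sine in terms of the q-Gamma function. -/
theorem qSin_eq_qGamma (q z : ℝ) (hq0 : 0 < q) (hq1 : q < 1) :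
    qSin q (π * z) =
      q ^ ((1 : ℝ) / 4) * (qGamma (q ^ 2) (1 / 2)) ^ 2 * (q ^ 2) ^ (z * (z - 1) / 2) /
        (qGamma (q ^ 2) z * qGamma (q ^ 2) (1 - z)) := by
  have hr0 : 0 < q ^ 2 := pow_pos hq0 2
  have hr1 : q ^ 2 < 1 := pow_lt_one₀ hq0.le hq1 two_ne_zero
  have hQ := qPoch_self_ne_zero hr0 hr1
  have hpow (x : ℝ) : (q ^ 2) ^ x = q ^ (2 * x) := by
    rw [rpow_mul hq0.le, rpow_two]
  have hsub : 0 < 1 - q ^ 2 := sub_pos.mpr hr1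
  have hone : (1 - q ^ 2) ^ (1 - z) * (1 - q ^ 2) ^ z = 1 - q ^ 2 := by
    rw [← rpow_add hsub, sub_add_cancel, rpow_one]
  have hsqrt : ((1 - q ^ 2) ^ (1 - 1 / 2 : ℝ)) ^ 2 = 1 - q ^ 2 := by
    rw [← rpow_mul_natCast hsub.le]
    norm_num
  have hexp : q ^ ((z - 1 / 2) ^ 2) = q ^ ((1 : ℝ) / 4) * q ^ (2 * (z * (z - 1) / 2)) := by
    rw [← rpow_add hq0]
    ring_nf
  have hhalf : q ^ (2 * (1 / 2 : ℝ)) = q := by norm_num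
  have hrefl : 2 * (1 - z) = 2 - 2 * z := by ring
  have hden : qGamma (q ^ 2) z * qGamma (q ^ 2) (1 - z) =
      qPoch (q ^ 2) (q ^ 2) ^ 2 * (1 - q ^ 2) /
        (qPoch (q ^ (2 * z)) (q ^ 2) * qPoch (q ^ (2 - 2 * z)) (q ^ 2)) := by
    simp only [qGamma, hpow, hrefl, sub_sub_cancel]
    rw [mul_mul_mul_comm, hone, div_mul_div_comm]
    ring
  have hnum : qGamma (q ^ 2) (1 / 2) ^ 2 =
      qPoch (q ^ 2) (q ^ 2) ^ 2 * (1 - q ^ 2) / qPoch q (q ^ 2) ^ 2 := by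
    simp only [qGamma, hpow, hhalf]
    rw [mul_pow, hsqrt, div_pow]
    ring
  have hc : qPoch (q ^ 2) (q ^ 2) ^ 2 * (1 - q ^ 2) ≠ 0 := by positivity
  rw [hden, hnum, qSin, mul_div_cancel_left₀ z pi_ne_zero, hexp, hpow]
  generalize qPoch (q ^ 2) (q ^ 2) ^ 2 * (1 - q ^ 2) = c at hc
  rw [div_div_eq_mul_div, eq_div_iff hc]
  ring
end

section
/- For every real q with 0 < q < 1 and every real z, one has (q²;q²)_∞³ (1−q²) / (Γ_{q²}(z) · Γ_{q²}(1−z)) = ∑_{n∈ℤ} (−1)ⁿ q^{n²} q^{n(2z−1)}. -/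
open Real

open Filter Topology Finset in
theorem qPoch_tendsto {q : ℝ} (hq0 : 0 < q) (hq1 : q < 1) (x : ℝ) :
    Tendsto (fun N : ℕ => ∏ k ∈ range N, (1 - x * q ^ k)) atTop (𝓝 (qPoch x q)) := by
  have hs : Summable fun k : ℕ => ‖-(x * q ^ k)‖ := by
    simpa [abs_of_pos hq0] using (summable_geometric_of_lt_one hq0.le hq1).mul_left |x|
  have hm := multipliable_one_add_of_summable hs
  simpa [qPoch, sub_eq_add_neg] using hm.tendsto_prod_tprod_nat

theorem one_sub_mul_pow_pos {q : ℝ} (hq0 : 0 < q) (hq1 : q < 1) (k : ℕ) :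
    0 < 1 - q * q ^ k := by
  have := pow_lt_one₀ hq0.le hq1 k.succ_ne_zero
  rw [pow_succ'] at this
  linarith

theorem qPoch_self_pos_s4 {q : ℝ} (hq0 : 0 < q) (hq1 : q < 1) : 0 < qPoch q q := by
  have hs : Summable fun k : ℕ => ‖-(q * q ^ k)‖ := by
    simpa [abs_of_pos hq0] using (summable_geometric_of_lt_one hq0.le hq1).mul_left q
  have hne : qPoch q q ≠ 0 := by
    have := tprod_one_add_ne_zero_of_summable (f := fun k : ℕ => -(q * q ^ k))
      (fun k => by simpa [← sub_eq_add_neg] using (one_sub_mul_pow_pos hq0 hq1 k).ne') hs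
    simpa [qPoch, sub_eq_add_neg] using this
  refine lt_of_le_of_ne ?_ hne.symm
  exact ge_of_tendsto' (qPoch_tendsto hq0 hq1 q)
    fun N => Finset.prod_nonneg fun k _ => (one_sub_mul_pow_pos hq0 hq1 k).le

/-- The finite q-Pochhammer symbol `(q; q)_m`. -/
noncomputable def qFac (q : ℝ) (m : ℕ) : ℝ := ∏ k ∈ Finset.range m, (1 - q * q ^ k)

theorem qFac_succ (q : ℝ) (m : ℕ) : qFac q (m + 1) = qFac q m * (1 - q ^ (m + 1)) := by
  rw [qFac, Finset.prod_range_succ, pow_succ', qFac]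

theorem qFac_pos {q : ℝ} (hq0 : 0 < q) (hq1 : q < 1) (m : ℕ) : 0 < qFac q m :=
  Finset.prod_pos fun k _ => one_sub_mul_pow_pos hq0 hq1 k

theorem qFac_antitone {q : ℝ} (hq0 : 0 < q) (hq1 : q < 1) : Antitone (qFac q) := by
  refine antitone_nat_of_succ_le fun m => ?_
  rw [qFac_succ]
  exact mul_le_of_le_one_right (qFac_pos hq0 hq1 m).le (by linarith [pow_pos hq0 (m + 1)])

theorem qFac_le_one {q : ℝ} (hq0 : 0 < q) (hq1 : q < 1) (m : ℕ) : qFac q m ≤ 1 := by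
  simpa [qFac] using qFac_antitone hq0 hq1 m.zero_le

theorem qPoch_self_le_qFac {q : ℝ} (hq0 : 0 < q) (hq1 : q < 1) (m : ℕ) :
    qPoch q q ≤ qFac q m :=
  (qFac_antitone hq0 hq1).le_of_tendsto (qPoch_tendsto hq0 hq1 q) m

/-- The reciprocal of `(q; q)_m`, extended by zero to negative `m`. -/
noncomputable def qFacInv (q : ℝ) (m : ℤ) : ℝ := if 0 ≤ m then (qFac q m.toNat)⁻¹ else 0

theorem qFacInv_natCast (q : ℝ) (m : ℕ) : qFacInv q m = (qFac q m)⁻¹ := by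
  simp [qFacInv]

theorem qFacInv_of_neg (q : ℝ) {m : ℤ} (hm : m < 0) : qFacInv q m = 0 := by
  simp [qFacInv, hm]

theorem qFacInv_sub_one {q : ℝ} (hq0 : 0 < q) (hq1 : q < 1) (m : ℤ) :
    qFacInv q (m - 1) = (1 - q ^ m) * qFacInv q m := by
  rcases lt_trichotomy m 0 with hm | rfl | hm
  · rw [qFacInv_of_neg q hm, qFacInv_of_neg q (by lia), mul_zero]
  · simp [qFacInv]
  · obtain ⟨k, rfl⟩ : ∃ k : ℕ, m = (k + 1 : ℕ) := ⟨(m - 1).toNat, by lia⟩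
    rw [show ((k + 1 : ℕ) : ℤ) - 1 = (k : ℕ) by simp, qFacInv_natCast, qFacInv_natCast, qFac_succ,
      zpow_natCast]
    have h1 := (qFac_pos hq0 hq1 k).ne'
    have h2 : 1 - q ^ (k + 1) ≠ 0 := by
      have := pow_lt_one₀ hq0.le hq1 k.succ_ne_zero
      exact (sub_pos.2 this).ne'
    field_simp

theorem qFacInv_nonneg {q : ℝ} (hq0 : 0 < q) (hq1 : q < 1) (m : ℤ) : 0 ≤ qFacInv q m := by
  unfold qFacInv
  split_ifs
  · exact (inv_pos.2 (qFac_pos hq0 hq1 _)).le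
  · exact le_rfl

theorem qFacInv_le {q : ℝ} (hq0 : 0 < q) (hq1 : q < 1) (m : ℤ) :
    qFacInv q m ≤ (qPoch q q)⁻¹ := by
  have hL := qPoch_self_pos_s4 hq0 hq1
  unfold qFacInv
  split_ifs
  · exact inv_anti₀ hL (qPoch_self_le_qFac hq0 hq1 _)
  · exact (inv_pos.2 hL).le

open Filter Topology in
theorem qFacInv_tendsto {q : ℝ} (hq0 : 0 < q) (hq1 : q < 1) :
    Tendsto (qFacInv q) atTop (𝓝 (qPoch q q)⁻¹) := by
  have h : Tendsto (fun m : ℤ => (qFac q m.toNat)⁻¹) atTop (𝓝 (qPoch q q)⁻¹) :=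
    ((qPoch_tendsto hq0 hq1 q).inv₀ (qPoch_self_pos_s4 hq0 hq1).ne').comp
      (tendsto_atTop.2 fun b => (eventually_ge_atTop (b : ℤ)).mono fun m hm => by lia)
  refine h.congr' ((eventually_ge_atTop 0).mono fun m hm => ?_)
  simp [qFacInv, hm]

/-- The central Gaussian binomial coefficient `[2N, N+n]_q`, zero for `|n| > N`. -/
noncomputable def centralGauss (q : ℝ) (N : ℕ) (n : ℤ) : ℝ :=
  qFac q (2 * N) * qFacInv q (N - n) * qFacInv q (N + n)

theorem centralGauss_succ {q : ℝ} (hq0 : 0 < q) (hq1 : q < 1) (N : ℕ) (n : ℤ) :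
    centralGauss q (N + 1) n = (1 + q ^ (2 * N + 1)) * centralGauss q N n +
      q ^ ((N : ℤ) + 1 - n) * centralGauss q N (n - 1) +
      q ^ ((N : ℤ) + 1 + n) * centralGauss q N (n + 1) := by
  have hA := qFacInv_sub_one hq0 hq1 ((N : ℤ) + 1 - n)
  have hA' := qFacInv_sub_one hq0 hq1 ((N : ℤ) - n)
  have hB := qFacInv_sub_one hq0 hq1 ((N : ℤ) + 1 + n)
  have hB' := qFacInv_sub_one hq0 hq1 ((N : ℤ) + n)
  have eA : q ^ ((N : ℤ) + 1 - n) = q * q ^ ((N : ℤ) - n) := by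
    rw [← zpow_one_add₀ hq0.ne']; congr 1; ring
  have eB : q ^ ((N : ℤ) + 1 + n) = q * q ^ ((N : ℤ) + n) := by
    rw [← zpow_one_add₀ hq0.ne']; congr 1; ring
  have eAB : q ^ (2 * N) = q ^ ((N : ℤ) - n) * q ^ ((N : ℤ) + n) := by
    rw [← zpow_add₀ hq0.ne', ← zpow_natCast]; congr 1; push_cast; ring
  rw [show (N : ℤ) + 1 - n - 1 = N - n by ring] at hA
  rw [show (N : ℤ) + 1 + n - 1 = N + n by ring] at hB
  unfold centralGauss
  rw [show 2 * (N + 1) = 2 * N + 1 + 1 by ring, qFac_succ, qFac_succ, Nat.cast_succ,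
    show (N : ℤ) - (n - 1) = N + 1 - n by ring, show (N : ℤ) + (n - 1) = N + n - 1 by ring,
    show (N : ℤ) - (n + 1) = N - n - 1 by ring, show (N : ℤ) + (n + 1) = N + 1 + n by ring,
    hA', hB', hA, hB, pow_succ q (2 * N + 1), pow_succ q (2 * N), eAB, eA, eB]
  ring

theorem centralGauss_norm_le {q : ℝ} (hq0 : 0 < q) (hq1 : q < 1) (N : ℕ) (n : ℤ) :
    ‖centralGauss q N n‖ ≤ (qPoch q q)⁻¹ * (qPoch q q)⁻¹ := by
  have h1 := qFac_pos hq0 hq1 (2 * N)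
  have h2 := qFacInv_nonneg hq0 hq1 (N - n)
  have h3 := qFacInv_nonneg hq0 hq1 (N + n)
  rw [centralGauss, Real.norm_of_nonneg (by positivity)]
  exact mul_le_mul ((mul_le_of_le_one_left h2 (qFac_le_one hq0 hq1 _)).trans
    (qFacInv_le hq0 hq1 _)) (qFacInv_le hq0 hq1 _) h3 (inv_pos.2 (qPoch_self_pos_s4 hq0 hq1)).le

open Filter Topology in
theorem centralGauss_tendsto {q : ℝ} (hq0 : 0 < q) (hq1 : q < 1) (n : ℤ) :
    Tendsto (fun N : ℕ => centralGauss q N n) atTop (𝓝 (qPoch q q)⁻¹) := by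
  have h1 : Tendsto (fun N : ℕ => qFac q (2 * N)) atTop (𝓝 (qPoch q q)) :=
    (qPoch_tendsto hq0 hq1 q).comp (tendsto_id.const_mul_atTop' two_pos)
  have h2 : Tendsto (fun N : ℕ => qFacInv q (N - n)) atTop (𝓝 (qPoch q q)⁻¹) :=
    (qFacInv_tendsto hq0 hq1).comp
      (tendsto_atTop_add_const_right _ (-n) tendsto_natCast_atTop_atTop)
  have h3 : Tendsto (fun N : ℕ => qFacInv q (N + n)) atTop (𝓝 (qPoch q q)⁻¹) :=
    (qFacInv_tendsto hq0 hq1).comp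
      (tendsto_atTop_add_const_right _ n tendsto_natCast_atTop_atTop)
  have h := (h1.mul h2).mul h3
  rwa [mul_inv_cancel₀ (qPoch_self_pos_s4 hq0 hq1).ne', one_mul] at h

/-- The general term `(-1)ⁿ q^{n²} xⁿ` of the theta series. -/
noncomputable def thetaTerm (q x : ℝ) (n : ℤ) : ℝ := (-1) ^ n * q ^ (n ^ 2) * x ^ n

theorem thetaTerm_add_one {q x : ℝ} (hq : q ≠ 0) (hx : x ≠ 0) (n : ℤ) :
    thetaTerm q x (n + 1) = -(x * q ^ (2 * n + 1)) * thetaTerm q x n := by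
  rw [thetaTerm, thetaTerm, show (n + 1) ^ 2 = n ^ 2 + (2 * n + 1) by ring, zpow_add₀ hq,
    zpow_add_one₀ hx, zpow_add_one₀ (by norm_num)]
  ring

theorem summable_thetaTerm {q x : ℝ} (hq0 : 0 < q) (hq1 : q < 1) (hx : x ≠ 0) :
    Summable (thetaTerm q x) := by
  have key : ∀ y : ℝ, y ≠ 0 → Summable fun n : ℕ => thetaTerm q y n := by
    intro y hy
    have hne : ∀ n : ℕ, thetaTerm q y n ≠ 0 := fun n => by
      unfold thetaTerm
      have := zpow_ne_zero ((n : ℤ) ^ 2) hq0.ne'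
      have := zpow_ne_zero (n : ℤ) hy
      have := zpow_ne_zero (n : ℤ) (show (-1 : ℝ) ≠ 0 by norm_num)
      positivity
    refine summable_of_ratio_test_tendsto_lt_one (l := 0) one_pos (.of_forall hne) ?_
    have hr : ∀ n : ℕ, ‖thetaTerm q y (n + 1 : ℕ)‖ / ‖thetaTerm q y n‖ =
        |y| * q * (q ^ 2) ^ n := fun n => by
      rw [Nat.cast_succ, thetaTerm_add_one hq0.ne' hy, norm_mul,
        mul_div_cancel_right₀ _ (norm_ne_zero_iff.2 (hne n)), norm_neg, norm_mul,
        Real.norm_eq_abs, Real.norm_eq_abs, abs_of_pos (zpow_pos hq0 _),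
        show (2 * (n : ℤ) + 1) = ((2 * n + 1 : ℕ) : ℤ) by push_cast; ring, zpow_natCast,
        pow_succ, pow_mul]
      ring
    simp_rw [hr]
    simpa using (tendsto_pow_atTop_nhds_zero_of_lt_one (by positivity)
      (pow_lt_one₀ hq0.le hq1 two_ne_zero)).const_mul (|y| * q)
  refine Summable.of_nat_of_neg (key x hx) ?_
  refine (key x⁻¹ (inv_ne_zero hx)).congr fun n => ?_
  rw [thetaTerm, thetaTerm, neg_sq, zpow_neg x, inv_zpow, zpow_neg (-1),
    ← inv_zpow (-1), inv_neg_one]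

theorem hasSum_thetaTerm_mul_centralGauss {q x : ℝ} (hq0 : 0 < q) (hq1 : q < 1) (hx : x ≠ 0)
    (N : ℕ) :
    HasSum (fun n : ℤ => thetaTerm q x n * centralGauss (q ^ 2) N n)
      ((∏ k ∈ Finset.range N, (1 - x * q * (q ^ 2) ^ k)) *
        ∏ k ∈ Finset.range N, (1 - x⁻¹ * q * (q ^ 2) ^ k)) := by
  have hp0 : 0 < q ^ 2 := by positivity
  have hp1 : q ^ 2 < 1 := pow_lt_one₀ hq0.le hq1 two_ne_zero
  induction N with
  | zero =>
    have h := hasSum_single (f := fun n : ℤ => thetaTerm q x n * centralGauss (q ^ 2) 0 n) 0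
      fun n hn => by
        rcases lt_or_gt_of_ne hn with h | h
        · simp [centralGauss, qFacInv_of_neg _ h]
        · simp [centralGauss, qFacInv_of_neg _ (neg_lt_zero.2 h)]
    simpa [thetaTerm, centralGauss, qFacInv, qFac] using h
  | succ N ih =>
    have hm := (Equiv.subRight (1 : ℤ)).hasSum_iff.2 ih
    have hp := (Equiv.addRight (1 : ℤ)).hasSum_iff.2 ih
    have h := ((ih.mul_left (1 + (q ^ 2) ^ (2 * N + 1))).sub
      (hm.mul_left (x * q ^ (2 * N + 1)))).sub (hp.mul_left (x⁻¹ * q ^ (2 * N + 1)))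
    convert h using 1
    · rfl
    · funext n
      have e1 := thetaTerm_add_one hq0.ne' hx (n - 1)
      have e2 := thetaTerm_add_one hq0.ne' hx n
      rw [sub_add_cancel] at e1
      have z1 : (q ^ 2) ^ ((N : ℤ) + 1 - n) * q ^ (2 * (n - 1) + 1) = q ^ (2 * N + 1) := by
        rw [← zpow_natCast q 2, ← zpow_mul, ← zpow_add₀ hq0.ne', ← zpow_natCast]
        congr 1; push_cast; ring
      have z2 : (q ^ 2) ^ ((N : ℤ) + 1 + n) = q ^ (2 * N + 1) * q ^ (2 * n + 1) := by
        rw [← zpow_natCast q 2, ← zpow_mul, ← zpow_natCast q (2 * N + 1), ← zpow_add₀ hq0.ne']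
        congr 1; push_cast; ring
      simp only [Function.comp_apply, Equiv.subRight_apply, Equiv.coe_addRight]
      rw [centralGauss_succ hp0 hp1, e2, z2, mul_add, mul_add, ← z1, e1]
      field_simp
      ring
    · rw [Finset.prod_range_succ, Finset.prod_range_succ]
      field_simp
      ring

open Filter Topology in
/-- The Jacobi triple product identity. -/
theorem tsum_thetaTerm {q x : ℝ} (hq0 : 0 < q) (hq1 : q < 1) (hx : x ≠ 0) :
    ∑' n : ℤ, thetaTerm q x n =
      qPoch (q ^ 2) (q ^ 2) * qPoch (x * q) (q ^ 2) * qPoch (x⁻¹ * q) (q ^ 2) := by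
  have hp0 : 0 < q ^ 2 := by positivity
  have hp1 : q ^ 2 < 1 := pow_lt_one₀ hq0.le hq1 two_ne_zero
  have hL := (qPoch_self_pos_s4 hp0 hp1).ne'
  have h1 := tendsto_tsum_of_dominated_convergence
    (f := fun (N : ℕ) (n : ℤ) => thetaTerm q x n * centralGauss (q ^ 2) N n) (𝓕 := atTop)
    ((summable_thetaTerm hq0 hq1 hx).norm.mul_right
      ((qPoch (q ^ 2) (q ^ 2))⁻¹ * (qPoch (q ^ 2) (q ^ 2))⁻¹))
    (fun n => (centralGauss_tendsto hp0 hp1 n).const_mul (thetaTerm q x n))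
    (.of_forall fun N n => by
      rw [norm_mul]
      exact mul_le_mul_of_nonneg_left (centralGauss_norm_le hp0 hp1 N n) (norm_nonneg _))
  simp_rw [(hasSum_thetaTerm_mul_centralGauss hq0 hq1 hx _).tsum_eq] at h1
  have h2 := (qPoch_tendsto hp0 hp1 (x * q)).mul (qPoch_tendsto hp0 hp1 (x⁻¹ * q))
  have h := tendsto_nhds_unique h1 h2
  rw [tsum_mul_right] at h
  rw [mul_assoc, ← h]
  field_simp

/-- the q-Gamma reflection formula as a bilateral sum. -/
theorem qGamma_reflection_sum (q z : ℝ) (hq0 : 0 < q) (hq1 : q < 1) :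
    (qPoch (q ^ 2) (q ^ 2)) ^ 3 * (1 - q ^ 2) / (qGamma (q ^ 2) z * qGamma (q ^ 2) (1 - z)) =
      ∑' n : ℤ, (-1 : ℝ) ^ n * q ^ ((n : ℝ) ^ 2) * q ^ ((n : ℝ) * (2 * z - 1)) := by
  have hp0 : 0 < q ^ 2 := by positivity
  have hp1 : q ^ 2 < 1 := pow_lt_one₀ hq0.le hq1 two_ne_zero
  have hL := (qPoch_self_pos_s4 hp0 hp1).ne'
  have hterm : ∀ n : ℤ, (-1 : ℝ) ^ n * q ^ ((n : ℝ) ^ 2) * q ^ ((n : ℝ) * (2 * z - 1)) =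
      thetaTerm q (q ^ (2 * z - 1)) n := fun n => by
    rw [thetaTerm, mul_comm (n : ℝ), Real.rpow_mul hq0.le, Real.rpow_intCast,
      ← Real.rpow_intCast q (n ^ 2), Int.cast_pow]
  have hx : q ^ (2 * z - 1) * q = (q ^ 2) ^ z := by
    rw [← Real.rpow_add_one hq0.ne', ← Real.rpow_natCast q 2, ← Real.rpow_mul hq0.le]
    congr 1; push_cast; ring
  have hx' : (q ^ (2 * z - 1))⁻¹ * q = (q ^ 2) ^ (1 - z) := by
    rw [← Real.rpow_neg hq0.le, ← Real.rpow_add_one hq0.ne', ← Real.rpow_natCast q 2,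
      ← Real.rpow_mul hq0.le]
    congr 1; push_cast; ring
  have hpow : (1 - q ^ 2) ^ (1 - z) * (1 - q ^ 2) ^ (1 - (1 - z)) = 1 - q ^ 2 := by
    rw [← Real.rpow_add (sub_pos.2 hp1)]
    simp
  simp_rw [hterm]
  rw [tsum_thetaTerm hq0 hq1 (Real.rpow_pos_of_pos hq0 _).ne', hx, hx', qGamma, qGamma,
    mul_mul_mul_comm, hpow, mul_div_mul_right _ _ (sub_pos.2 hp1).ne', div_mul_div_comm,
    div_div_eq_mul_div, div_eq_iff (mul_ne_zero hL hL)]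
  ring
end

section
/- For every real q with 0 < q < 1 and every real z, sin_q(πz) = q^{(z−1/2)²} · ((q²;q²)_∞ / (q;q)_∞²) · ∑_{n∈ℤ} (−1)ⁿ q^{n²} q^{n(2z−1)}. -/
open Real

open Filter Topology

/-- The finite `q`-Pochhammer product `(x; q)_n`. -/
noncomputable def qPochFin (x q : ℝ) (n : ℕ) : ℝ := ∏ k ∈ Finset.range n, (1 - x * q ^ k)

/-- The reciprocal `1 / (q; q)_m` for integer `m`, which is zero for negative `m`. -/
noncomputable def qFactInv (q : ℝ) (m : ℤ) : ℝ :=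
  if m < 0 then 0 else (qPochFin q q m.toNat)⁻¹

lemma qPochFin_succ (x q : ℝ) (n : ℕ) :
    qPochFin x q (n + 1) = qPochFin x q n * (1 - x * q ^ n) :=
  Finset.prod_range_succ _ _

lemma multipliable_qPoch (x : ℝ) {q : ℝ} (hq0 : 0 < q) (hq1 : q < 1) :
    Multipliable fun n : ℕ ↦ 1 - x * q ^ n := by
  simpa only [sub_eq_add_neg] using Real.multipliable_one_add_of_summable
    ((summable_geometric_of_lt_one hq0.le hq1).mul_left x).neg

lemma tendsto_qPochFin (x : ℝ) {q : ℝ} (hq0 : 0 < q) (hq1 : q < 1) :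
    Tendsto (qPochFin x q) atTop (𝓝 (qPoch x q)) :=
  (multipliable_qPoch x hq0 hq1).tendsto_prod_tprod_nat

lemma qPochFin_pos {x q : ℝ} (hx1 : x < 1) (hq0 : 0 < q) (hq1 : q < 1) (n : ℕ) :
    0 < qPochFin x q n := by
  refine Finset.prod_pos fun k _ ↦ ?_
  have h1 := pow_le_one₀ hq0.le hq1.le (n := k)
  have h2 := pow_pos hq0 k
  nlinarith

lemma qPochFin_antitone {x q : ℝ} (hx0 : 0 < x) (hx1 : x < 1) (hq0 : 0 < q) (hq1 : q < 1) :
    Antitone (qPochFin x q) := by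
  refine antitone_nat_of_succ_le fun n ↦ ?_
  rw [qPochFin_succ]
  have := qPochFin_pos hx1 hq0 hq1 n
  have := mul_pos hx0 (pow_pos hq0 n)
  nlinarith

lemma qPoch_le_qPochFin {x q : ℝ} (hx0 : 0 < x) (hx1 : x < 1) (hq0 : 0 < q) (hq1 : q < 1)
    (n : ℕ) : qPoch x q ≤ qPochFin x q n :=
  (qPochFin_antitone hx0 hx1 hq0 hq1).le_of_tendsto (tendsto_qPochFin x hq0 hq1) n

lemma qPoch_pos {x q : ℝ} (hx0 : 0 < x) (hx1 : x < 1) (hq0 : 0 < q) (hq1 : q < 1) :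
    0 < qPoch x q := by
  refine lt_of_le_of_ne
    (ge_of_tendsto' (tendsto_qPochFin x hq0 hq1) fun n ↦ (qPochFin_pos hx1 hq0 hq1 n).le)
    (Ne.symm ?_)
  have h := tprod_one_add_ne_zero_of_summable (f := fun n : ℕ ↦ -(x * q ^ n)) (fun n ↦ ?_)
    ((summable_geometric_of_lt_one hq0.le hq1).mul_left x).neg.norm
  · simpa only [qPoch, sub_eq_add_neg] using h
  · have h1 := pow_le_one₀ hq0.le hq1.le (n := n)
    have h2 := pow_pos hq0 n
    nlinarith

lemma qPochFin_self_le_one {q : ℝ} (hq0 : 0 < q) (hq1 : q < 1) (n : ℕ) :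
    qPochFin q q n ≤ 1 := by
  simpa [qPochFin] using qPochFin_antitone hq0 hq1 hq0 hq1 (Nat.zero_le n)

lemma qFactInv_sub_one {q : ℝ} (hq0 : 0 < q) (hq1 : q < 1) (m : ℤ) :
    qFactInv q (m - 1) = (1 - q ^ m) * qFactInv q m := by
  rcases lt_trichotomy m 0 with hm | rfl | hm
  · simp [qFactInv, hm, show m < 1 by omega]
  · simp [qFactInv]
  · obtain ⟨n, rfl⟩ : ∃ n : ℕ, m = n + 1 := ⟨(m - 1).toNat, by omega⟩
    have h1 : ¬ ((n : ℤ) + 1 < 0) := by omega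
    have h2 : ((n : ℤ) + 1).toNat = n + 1 := by omega
    have h3 : 1 - q * q ^ n ≠ 0 := by
      have h1 := pow_le_one₀ hq0.le hq1.le (n := n)
      have h2 := pow_pos hq0 n
      nlinarith
    have h4 : q ^ ((n : ℤ) + 1) = q * q ^ n := by
      rw [zpow_add_one₀ hq0.ne', zpow_natCast, mul_comm]
    have h5 := (qPochFin_pos hq1 hq0 hq1 n).ne'
    simp only [qFactInv, h1, h2, h4, add_sub_cancel_right, qPochFin_succ, if_false,
      Int.toNat_natCast, if_neg (not_lt.mpr (Int.natCast_nonneg n))]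
    field_simp

lemma qFactInv_nonneg {q : ℝ} (hq0 : 0 < q) (hq1 : q < 1) (m : ℤ) : 0 ≤ qFactInv q m := by
  unfold qFactInv
  split_ifs
  · rfl
  · exact (inv_pos.mpr (qPochFin_pos hq1 hq0 hq1 _)).le

lemma qFactInv_le {q : ℝ} (hq0 : 0 < q) (hq1 : q < 1) (m : ℤ) :
    qFactInv q m ≤ (qPoch q q)⁻¹ := by
  have h := qPoch_pos hq0 hq1 hq0 hq1
  unfold qFactInv
  split_ifs
  · positivity
  · exact inv_anti₀ h (qPoch_le_qPochFin hq0 hq1 hq0 hq1 _)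

lemma tendsto_qFactInv {q : ℝ} (hq0 : 0 < q) (hq1 : q < 1) :
    Tendsto (qFactInv q) atTop (𝓝 (qPoch q q)⁻¹) := by
  have h1 : Tendsto Int.toNat atTop atTop :=
    tendsto_atTop.mpr fun b ↦ (eventually_ge_atTop (b : ℤ)).mono fun m hm ↦ by omega
  have h := (((tendsto_qPochFin q hq0 hq1).comp h1).inv₀ (qPoch_pos hq0 hq1 hq0 hq1).ne')
  refine h.congr' ((eventually_ge_atTop 0).mono fun m hm ↦ ?_)
  simp [qFactInv, not_lt.mpr hm]

/-- The terms of the finite form of the Jacobi triple product identity. -/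
noncomputable def finiteTripleTerm (q x : ℝ) (n : ℕ) (j : ℤ) : ℝ :=
  (-1) ^ j * q ^ (j ^ 2) * x ^ j *
    (qPochFin (q ^ 2) (q ^ 2) (2 * n) * qFactInv (q ^ 2) (n + j) * qFactInv (q ^ 2) (n - j))

lemma finiteTripleTerm_succ {q x : ℝ} (hq0 : 0 < q) (hq1 : q < 1) (hx : x ≠ 0) (n : ℕ) (j : ℤ) :
    finiteTripleTerm q x (n + 1) j =
      (1 + q ^ (4 * n + 2)) * finiteTripleTerm q x n j +
        -(x * q ^ (2 * n + 1)) * finiteTripleTerm q x n (j - 1) +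
        -(x⁻¹ * q ^ (2 * n + 1)) * finiteTripleTerm q x n (j + 1) := by
  have hQ0 : 0 < q ^ 2 := by positivity
  have hQ1 : q ^ 2 < 1 := pow_lt_one₀ hq0.le hq1 two_ne_zero
  have hq := hq0.ne'
  have r1 := qFactInv_sub_one hQ0 hQ1 (n + 1 + j)
  have r2 := qFactInv_sub_one hQ0 hQ1 (n + 1 - j)
  have r3 := qFactInv_sub_one hQ0 hQ1 (n + j)
  have r4 := qFactInv_sub_one hQ0 hQ1 (n - j)
  rw [show (n : ℤ) + 1 + j - 1 = n + j by ring] at r1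
  rw [show (n : ℤ) + 1 - j - 1 = n - j by ring] at r2
  have hm : (-1 : ℝ) ^ (j - 1) = -(-1) ^ j := by rw [zpow_sub_one₀ (by norm_num)]; norm_num
  have hp : (-1 : ℝ) ^ (j + 1) = -(-1) ^ j := by rw [zpow_add_one₀ (by norm_num)]; norm_num
  unfold finiteTripleTerm
  rw [show 2 * (n + 1) = 2 * n + 1 + 1 by ring, qPochFin_succ, qPochFin_succ, hm, hp,
    show (n : ℤ) + (j - 1) = n + j - 1 by ring, show (n : ℤ) - (j - 1) = n + 1 - j by ring,
    show (n : ℤ) + (j + 1) = n + 1 + j by ring, show (n : ℤ) - (j + 1) = n - j - 1 by ring,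
    r3, r4, r1, r2, zpow_sub_one₀ hx, zpow_add_one₀ hx,
    show (j - 1) ^ 2 = j ^ 2 + 1 - j - j by ring, show (j + 1) ^ 2 = j ^ 2 + 1 + j + j by ring]
  push_cast
  simp only [zpow_sub₀ hq, zpow_add₀ hq, zpow_sub₀ hQ0.ne', zpow_add₀ hQ0.ne', zpow_one,
    zpow_natCast]
  have e1 : (q ^ 2) ^ j = q ^ j * q ^ j := by rw [sq, mul_zpow]
  have e2 : (q ^ 2) ^ n = q ^ n * q ^ n := by ring
  have e3 : q ^ (4 * n + 2) = (q ^ n) ^ 4 * q ^ 2 := by ring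
  have e4 : q ^ (2 * n + 1) = (q ^ n) ^ 2 * q := by ring
  have e5 : (q ^ 2) ^ (2 * n) = (q ^ n) ^ 4 := by ring
  have e6 : (q ^ 2) ^ (2 * n + 1) = (q ^ n) ^ 4 * q ^ 2 := by ring
  rw [e1, e2, e3, e4, e5, e6]
  have hJ : q ^ j ≠ 0 := zpow_ne_zero _ hq
  generalize q ^ j = J at *
  generalize q ^ n = N at *
  generalize qFactInv _ _ = R
  generalize qFactInv _ _ = S
  field_simp
  ring

lemma qPochFin_mul_qPochFin_succ {x : ℝ} (hx : x ≠ 0) (q : ℝ) (n : ℕ) :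
    qPochFin (x * q) (q ^ 2) (n + 1) * qPochFin (x⁻¹ * q) (q ^ 2) (n + 1) =
      (1 + q ^ (4 * n + 2)) * (qPochFin (x * q) (q ^ 2) n * qPochFin (x⁻¹ * q) (q ^ 2) n) +
        -(x * q ^ (2 * n + 1)) * (qPochFin (x * q) (q ^ 2) n * qPochFin (x⁻¹ * q) (q ^ 2) n) +
        -(x⁻¹ * q ^ (2 * n + 1)) *
          (qPochFin (x * q) (q ^ 2) n * qPochFin (x⁻¹ * q) (q ^ 2) n) := by
  have hxx := mul_inv_cancel₀ hx
  rw [qPochFin_succ, qPochFin_succ]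
  generalize qPochFin _ _ n = A
  generalize qPochFin _ _ n = B
  linear_combination A * B * q ^ (4 * n + 2) * hxx

lemma hasSum_finiteTripleTerm {q x : ℝ} (hq0 : 0 < q) (hq1 : q < 1) (hx : x ≠ 0) (n : ℕ) :
    HasSum (finiteTripleTerm q x n)
      (qPochFin (x * q) (q ^ 2) n * qPochFin (x⁻¹ * q) (q ^ 2) n) := by
  induction n with
  | zero =>
    have h : finiteTripleTerm q x 0 0 =
        qPochFin (x * q) (q ^ 2) 0 * qPochFin (x⁻¹ * q) (q ^ 2) 0 := by
      simp [finiteTripleTerm, qPochFin, qFactInv]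
    rw [← h]
    refine hasSum_single 0 fun j hj ↦ ?_
    rcases lt_or_gt_of_ne hj with hj | hj <;> simp [finiteTripleTerm, qFactInv, hj]
  | succ n ih =>
    have h1 : HasSum (fun j ↦ finiteTripleTerm q x n (j - 1))
        (qPochFin (x * q) (q ^ 2) n * qPochFin (x⁻¹ * q) (q ^ 2) n) :=
      (Equiv.subRight (1 : ℤ)).hasSum_iff.mpr ih
    have h2 : HasSum (fun j ↦ finiteTripleTerm q x n (j + 1))
        (qPochFin (x * q) (q ^ 2) n * qPochFin (x⁻¹ * q) (q ^ 2) n) :=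
      (Equiv.addRight (1 : ℤ)).hasSum_iff.mpr ih
    have h := ((ih.mul_left (1 + q ^ (4 * n + 2))).add
      (h1.mul_left (-(x * q ^ (2 * n + 1))))).add (h2.mul_left (-(x⁻¹ * q ^ (2 * n + 1))))
    rw [funext (finiteTripleTerm_succ hq0 hq1 hx n)]
    rw [qPochFin_mul_qPochFin_succ hx]
    exact h

lemma summable_triple {q x : ℝ} (hq0 : 0 < q) (hq1 : q < 1) (hx : 0 < x) :
    Summable fun j : ℤ ↦ q ^ (j ^ 2) * x ^ j := by
  have h := ((summable_jacobiTheta₂_term_iff (↑(-(log x) / (2 * π)) * Complex.I)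
    (↑(-(log q) / π) * Complex.I)).mpr ?_).norm
  · refine h.congr fun j ↦ ?_
    rw [norm_jacobiTheta₂_term, ← Real.rpow_intCast, ← Real.rpow_intCast, Real.rpow_def_of_pos hq0,
      Real.rpow_def_of_pos hx, ← Real.exp_add, Complex.im_ofReal_mul, Complex.im_ofReal_mul]
    congr 1
    have := Real.pi_ne_zero
    push_cast [Complex.I_im]
    field_simp
    ring
  · simpa using div_pos (neg_pos.mpr (Real.log_neg hq0 hq1)) Real.pi_pos

/-- The Jacobi triple product identity. -/
theorem jacobi_triple_product {q x : ℝ} (hq0 : 0 < q) (hq1 : q < 1) (hx : 0 < x) :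
    ∑' j : ℤ, (-1) ^ j * q ^ (j ^ 2) * x ^ j =
      qPoch (q ^ 2) (q ^ 2) * qPoch (x * q) (q ^ 2) * qPoch (x⁻¹ * q) (q ^ 2) := by
  have hQ0 : 0 < q ^ 2 := by positivity
  have hQ1 : q ^ 2 < 1 := pow_lt_one₀ hq0.le hq1 two_ne_zero
  have hE := qPoch_pos hQ0 hQ1 hQ0 hQ1
  have hlim := tendsto_tsum_of_dominated_convergence (𝓕 := atTop) (f := finiteTripleTerm q x)
    (g := fun j : ℤ ↦ (-1) ^ j * q ^ (j ^ 2) * x ^ j * (qPoch (q ^ 2) (q ^ 2))⁻¹)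
    ((summable_triple hq0 hq1 hx).mul_right ((qPoch (q ^ 2) (q ^ 2))⁻¹ ^ 2)) (fun j ↦ ?_)
    (Eventually.of_forall fun n j ↦ ?_)
  · simp only [(hasSum_finiteTripleTerm hq0 hq1 hx.ne' _).tsum_eq, tsum_mul_right] at hlim
    have h := tendsto_nhds_unique hlim
      ((tendsto_qPochFin (x * q) hQ0 hQ1).mul (tendsto_qPochFin (x⁻¹ * q) hQ0 hQ1))
    rw [mul_assoc, ← h]
    field_simp
  · have t1 : Tendsto (fun n : ℕ ↦ qPochFin (q ^ 2) (q ^ 2) (2 * n)) atTop _ :=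
      (tendsto_qPochFin (q ^ 2) hQ0 hQ1).comp
        (tendsto_id.const_mul_atTop' two_pos)
    have t2 : Tendsto (fun n : ℕ ↦ qFactInv (q ^ 2) (n + j)) atTop _ :=
      (tendsto_qFactInv hQ0 hQ1).comp
        (tendsto_atTop_add_const_right _ j tendsto_natCast_atTop_atTop)
    have t3 : Tendsto (fun n : ℕ ↦ qFactInv (q ^ 2) (n - j)) atTop _ :=
      (tendsto_qFactInv hQ0 hQ1).comp
        (tendsto_atTop_add_const_right _ (-j) tendsto_natCast_atTop_atTop)
    have h := ((t1.mul t2).mul t3).const_mul ((-1) ^ j * q ^ (j ^ 2) * x ^ j)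
    rwa [mul_inv_cancel₀ hE.ne', one_mul] at h
  · have hs : ‖(-1 : ℝ) ^ j‖ = 1 := by simp [norm_zpow]
    have n1 := qFactInv_nonneg hQ0 hQ1 (n + j)
    have n2 := qFactInv_nonneg hQ0 hQ1 (n - j)
    have n3 := (qPochFin_pos hQ1 hQ0 hQ1 (2 * n)).le
    have hw : 0 ≤ q ^ (j ^ 2) * x ^ j := by positivity
    rw [finiteTripleTerm, mul_assoc ((-1 : ℝ) ^ j), norm_mul, norm_mul, hs, one_mul,
      Real.norm_of_nonneg hw, Real.norm_of_nonneg (by positivity)]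
    refine mul_le_mul_of_nonneg_left ?_ hw
    rw [sq (qPoch _ _)⁻¹]
    refine mul_le_mul ?_ (qFactInv_le hQ0 hQ1 _) n2 (by positivity)
    exact (mul_le_of_le_one_left n1 (qPochFin_self_le_one hQ0 hQ1 _)).trans
      (qFactInv_le hQ0 hQ1 _)

lemma qPoch_self_eq_mul {q : ℝ} (hq0 : 0 < q) (hq1 : q < 1) :
    qPoch q q = qPoch q (q ^ 2) * qPoch (q ^ 2) (q ^ 2) := by
  have hQ0 : 0 < q ^ 2 := by positivity
  have hQ1 : q ^ 2 < 1 := pow_lt_one₀ hq0.le hq1 two_ne_zero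
  have he : (fun k : ℕ ↦ 1 - q * q ^ (2 * k)) = fun k ↦ 1 - q * (q ^ 2) ^ k := by
    simp only [pow_mul]
  have ho : (fun k : ℕ ↦ 1 - q * q ^ (2 * k + 1)) = fun k ↦ 1 - q ^ 2 * (q ^ 2) ^ k := by
    ext k
    ring
  have h := tprod_even_mul_odd (f := fun n : ℕ ↦ 1 - q * q ^ n)
    (he ▸ multipliable_qPoch q hQ0 hQ1) (ho ▸ multipliable_qPoch (q ^ 2) hQ0 hQ1)
  rw [he, ho] at h
  exact h.symm

/-- the summation formula for Gosper's q-sine. -/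
theorem qSin_summation (q z : ℝ) (hq0 : 0 < q) (hq1 : q < 1) :
    qSin q (π * z) =
      q ^ ((z - 1 / 2) ^ 2) * (qPoch (q ^ 2) (q ^ 2) / (qPoch q q) ^ 2) *
        ∑' n : ℤ, (-1 : ℝ) ^ n * q ^ ((n : ℝ) ^ 2) * q ^ ((n : ℝ) * (2 * z - 1)) := by
  have hQ0 : 0 < q ^ 2 := by positivity
  have hQ1 : q ^ 2 < 1 := pow_lt_one₀ hq0.le hq1 two_ne_zero
  have hE := (qPoch_pos hQ0 hQ1 hQ0 hQ1).ne'
  have hO := (qPoch_pos hq0 hq1 hQ0 hQ1).ne'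
  have hsum : ∀ n : ℤ, (-1 : ℝ) ^ n * q ^ ((n : ℝ) ^ 2) * q ^ ((n : ℝ) * (2 * z - 1)) =
      (-1) ^ n * q ^ (n ^ 2) * (q ^ (2 * z - 1)) ^ n := fun n ↦ by
    rw [mul_comm (n : ℝ), Real.rpow_mul hq0.le, Real.rpow_intCast, ← Real.rpow_intCast q (n ^ 2)]
    push_cast
    rfl
  have hx1 : q ^ (2 * z - 1) * q = q ^ (2 * z) := by
    rw [← Real.rpow_add_one hq0.ne', sub_add_cancel]
  have hx2 : (q ^ (2 * z - 1))⁻¹ * q = q ^ (2 - 2 * z) := by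
    rw [← Real.rpow_neg hq0.le, ← Real.rpow_add_one hq0.ne']
    congr 1
    ring
  rw [tsum_congr hsum, jacobi_triple_product hq0 hq1 (Real.rpow_pos_of_pos hq0 _), hx1, hx2,
    qPoch_self_eq_mul hq0 hq1, qSin, mul_div_cancel_left₀ z Real.pi_ne_zero]
  field_simp
end
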